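/- Let k ≥ 1 and 0 < δ < 1. If z ≤ C x^δ for a constant C, then ∑_{z ≤ N ≤ x, 2|N} μ²(N) r_0(N)^k / N ≫_{k,δ} (log x)^{2^{k-1}}. -/

import Mathlib

open scoped Classical

/-- `r₀(n)`: number of representations of `n` as a sum of two squares in the
first quadrant. -/
noncomputable def r0 (n : ℕ) : ℕ :=
  Nat.card {p : ℤ × ℤ // (n : ℤ) = p.1 ^ 2 + p.2 ^ 2 ∧ 0 ≤ p.1 ∧ 0 < p.2}

open Finset ArithmeticFunction in
theorem sum_vonMangoldt_div_sub_log_bounded :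
    ∃ C : ℝ, ∀ N : ℕ, 1 ≤ N → |∑ n ∈ Ioc 0 N, vonMangoldt n / n - Real.log N| ≤ C := by
  refine ⟨Real.log 4 + 5, fun N hN => ?_⟩
  have hN0 : (0 : ℝ) < N := by exact_mod_cast hN
  have hfac : Real.log (N.factorial) = ∑ n ∈ Ioc 0 N, vonMangoldt n * ((N / n : ℕ) : ℝ) := by
    rw [← sum_Ioc_mul_zeta_eq_sum, vonMangoldt_mul_zeta, ← Finset.prod_Ico_id_eq_factorial,
      Nat.cast_prod, Real.log_prod]
    · rfl
    · intro i hi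
      simp only [mem_Ico] at hi
      have : i ≠ 0 := by omega
      exact_mod_cast this
  have hpsi : ∑ n ∈ Ioc 0 N, vonMangoldt n ≤ (Real.log 4 + 4) * N := by
    have := Chebyshev.psi_le_const_mul_self hN0.le
    simpa [Chebyshev.psi] using this
  have hup : Real.log (N.factorial) ≤ N * Real.log N := by
    have : (N.factorial : ℝ) ≤ (N : ℝ) ^ N := by exact_mod_cast Nat.factorial_le_pow N
    calc _ ≤ Real.log ((N : ℝ) ^ N) := Real.log_le_log (by positivity) this
      _ = _ := by rw [Real.log_pow]
  have hlo : N * Real.log N - N ≤ Real.log (N.factorial) := by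
    have h1 := Stirling.le_log_factorial_stirling (n := N) (by omega)
    have h2 : 0 ≤ Real.log N := Real.log_nonneg (by exact_mod_cast hN)
    have h3 : 0 ≤ Real.log (2 * Real.pi) := Real.log_nonneg (by linarith [Real.pi_gt_three])
    linarith
  have hle : ∑ n ∈ Ioc 0 N, vonMangoldt n * ((N / n : ℕ) : ℝ) ≤
      N * ∑ n ∈ Ioc 0 N, vonMangoldt n / n := by
    rw [mul_sum]
    refine sum_le_sum fun n _ => ?_
    calc _ ≤ vonMangoldt n * ((N : ℝ) / n) :=
          mul_le_mul_of_nonneg_left Nat.cast_div_le vonMangoldt_nonneg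
      _ = _ := by ring
  have hge : N * ∑ n ∈ Ioc 0 N, vonMangoldt n / n - ∑ n ∈ Ioc 0 N, vonMangoldt n ≤
      ∑ n ∈ Ioc 0 N, vonMangoldt n * ((N / n : ℕ) : ℝ) := by
    rw [mul_sum, ← sum_sub_distrib]
    refine sum_le_sum fun n hn => ?_
    have hn0 : n ≠ 0 := by simp at hn; omega
    have h1 : (N : ℝ) / n - 1 ≤ ((N / n : ℕ) : ℝ) := by
      rw [← Nat.floor_div_eq_div (K := ℝ)]
      exact (Nat.sub_one_lt_floor _).le
    calc _ = vonMangoldt n * ((N : ℝ) / n - 1) := by ring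
      _ ≤ _ := mul_le_mul_of_nonneg_left h1 vonMangoldt_nonneg
  set S := ∑ n ∈ Ioc 0 N, vonMangoldt n / (n : ℝ)
  rw [abs_le]
  have hlog4 : 0 ≤ Real.log 4 := Real.log_nonneg (by norm_num)
  constructor
  · have : 0 ≤ N * (S - Real.log N + 1) := by nlinarith
    have := nonneg_of_mul_nonneg_right this hN0
    linarith
  · have : 0 ≤ N * (Real.log N + (Real.log 4 + 4) - S) := by nlinarith
    have := nonneg_of_mul_nonneg_right this hN0
    linarith

/-- The nontrivial Dirichlet character modulo `4`, with real values. -/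
noncomputable def chi (n : ℕ) : ℝ := (ZMod.χ₄ n : ℤ)

theorem chi_mul (m n : ℕ) : chi (m * n) = chi m * chi n := by
  rw [chi, chi, chi, Nat.cast_mul, map_mul, Int.cast_mul]

theorem chi_eq (n : ℕ) : chi n = if n % 2 = 0 then 0 else if n % 4 = 1 then 1 else -1 := by
  rw [chi, ZMod.χ₄_nat_eq_if_mod_four]
  split_ifs <;> simp

theorem abs_chi_le_one (n : ℕ) : |chi n| ≤ 1 := by
  rw [chi_eq]
  split_ifs <;> simp

open Finset in
theorem sum_chi (N : ℕ) :
    ∑ n ∈ Ioc 0 N, chi n = if N % 4 = 1 ∨ N % 4 = 2 then 1 else 0 := by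
  induction N with
  | zero => simp
  | succ N ih =>
    rw [Finset.sum_Ioc_succ_top (Nat.zero_le N), ih, chi_eq]
    have : N % 4 < 4 := Nat.mod_lt _ (by norm_num)
    interval_cases h : N % 4
    · rw [if_neg (by omega), if_neg (by omega), if_pos (by omega), if_pos (by omega)]; norm_num
    · rw [if_pos (by omega), if_pos (by omega), if_pos (by omega)]; norm_num
    · rw [if_pos (by omega), if_neg (by omega), if_neg (by omega), if_neg (by omega)]; norm_num
    · rw [if_neg (by omega), if_pos (by omega), if_neg (by omega)]; norm_num

open Finset in
theorem abs_sum_chi_mul_le {g : ℕ → ℝ} {M N : ℕ} (hMN : M ≤ N)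
    (hanti : ∀ n, M < n → g (n + 1) ≤ g n) (hnonneg : ∀ n, M < n → 0 ≤ g n) :
    |∑ n ∈ Ioc M N, chi n * g n| ≤ g (M + 1) := by
  have hX (n : ℕ) : 0 ≤ ∑ i ∈ Ioc 0 n, chi i ∧ ∑ i ∈ Ioc 0 n, chi i ≤ 1 := by
    rw [sum_chi]; split_ifs <;> norm_num
  have key : -g (M + 1) ≤ ∑ n ∈ Ioc M N, chi n * g n - (∑ i ∈ Ioc 0 N, chi i) * g (N + 1) ∧
      ∑ n ∈ Ioc M N, chi n * g n - (∑ i ∈ Ioc 0 N, chi i) * g (N + 1) ≤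
        g (M + 1) - g (N + 1) := by
    induction N, hMN using Nat.le_induction with
    | base =>
      have := hnonneg (M + 1) (by omega)
      have := hX M
      simp only [Ioc_self, sum_empty]
      constructor <;> nlinarith
    | succ N hN ih =>
      have h1 := hX (N + 1)
      have h2 := hanti (N + 1) (by omega)
      rw [Finset.sum_Ioc_succ_top hN]
      rw [Finset.sum_Ioc_succ_top (Nat.zero_le N)] at h1 ⊢
      constructor <;> nlinarith
  have h1 := hnonneg (N + 1) (by omega)
  have h2 := hX N
  rw [abs_le]
  constructor <;> nlinarith

open Finset in
theorem two_thirds_le_sum_chi_div {N : ℕ} (hN : 1 ≤ N) :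
    2 / 3 ≤ ∑ n ∈ Ioc 0 N, chi n * (n : ℝ)⁻¹ := by
  have h := abs_sum_chi_mul_le (g := fun n => (n : ℝ)⁻¹) (M := 2) (N := max N 2)
    (by simp)
    (fun n hn => by
      have : (0 : ℝ) < n := by exact_mod_cast (by omega : 0 < n)
      gcongr; simp) (fun n hn => by positivity)
  rcases Nat.lt_or_ge N 2 with h2 | h2
  · obtain rfl : N = 1 := by omega
    simp [chi_eq]; norm_num
  · rw [max_eq_left h2] at h
    rw [← Finset.sum_Ioc_consecutive _ (Nat.zero_le 2) h2]
    have : ∑ n ∈ Ioc 0 2, chi n * (n : ℝ)⁻¹ = 1 := by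
      rw [show Ioc 0 2 = {1, 2} by rfl]
      simp [chi_eq]
    rw [this]
    have := (abs_le.1 h).1
    norm_num at this ⊢
    linarith

open Finset ArithmeticFunction in
theorem sum_chi_mul_vonMangoldt_div_bounded :
    ∃ C : ℝ, ∀ N : ℕ, |∑ n ∈ Ioc 0 N, chi n * vonMangoldt n / n| ≤ C := by
  have hlogsum : ∃ C : ℝ, ∀ N : ℕ, |∑ n ∈ Ioc 0 N, chi n * (Real.log n / n)| ≤ C := by
    refine ⟨∑ n ∈ Ioc 0 2, |chi n * (Real.log n / n)| + Real.log (3 : ℕ) / (3 : ℕ),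
      fun N => ?_⟩
    have h3 : 0 ≤ Real.log (3 : ℕ) / (3 : ℕ) := by positivity
    rcases Nat.lt_or_ge N 2 with h2 | h2
    · refine (abs_sum_le_sum_abs _ _).trans ?_
      have : ∑ n ∈ Ioc 0 N, |chi n * (Real.log n / n)| ≤
          ∑ n ∈ Ioc 0 2, |chi n * (Real.log n / n)| :=
        sum_le_sum_of_subset_of_nonneg (Ioc_subset_Ioc_right h2.le) fun _ _ _ => abs_nonneg _
      linarith
    · rw [← Finset.sum_Ioc_consecutive _ (Nat.zero_le 2) h2]
      refine (abs_add_le _ _).trans (add_le_add (abs_sum_le_sum_abs _ _) ?_)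
      refine abs_sum_chi_mul_le (g := fun n : ℕ => Real.log n / n) h2 (fun n hn => ?_)
        fun n hn => by positivity
      have h3n : (3 : ℝ) ≤ n := by exact_mod_cast hn
      have he := Real.exp_one_lt_d9
      exact Real.log_div_self_antitoneOn (he.le.trans (by linarith))
        (he.le.trans (by push_cast; linarith)) (by simp)
  obtain ⟨C, hC⟩ := hlogsum
  refine ⟨3 / 2 * (C + (Real.log 4 + 4)), fun N => ?_⟩
  rcases Nat.eq_zero_or_pos N with rfl | hN
  · have := (abs_nonneg _).trans (hC 0)
    have : 0 ≤ Real.log 4 := Real.log_nonneg (by norm_num)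
    simp only [Ioc_self, sum_empty, abs_zero]
    positivity
  have hN0 : (0 : ℝ) < N := by exact_mod_cast hN
  let f : ArithmeticFunction ℝ := ⟨fun n => chi n * vonMangoldt n / n, by simp⟩
  let g : ArithmeticFunction ℝ := ⟨fun n => chi n * (n : ℝ)⁻¹, by simp⟩
  have hfg (n : ℕ) : (f * g) n = chi n * (Real.log n / n) := by
    rw [mul_apply]
    rcases eq_or_ne n 0 with rfl | hn
    · simp
    rw [← vonMangoldt_sum, ← Nat.sum_divisorsAntidiagonal (fun i _ => vonMangoldt i), sum_div,
      mul_sum]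
    refine sum_congr rfl fun x hx => ?_
    obtain ⟨hx, -⟩ := Nat.mem_divisorsAntidiagonal.1 hx
    simp only [f, g, coe_mk, ← hx, chi_mul]
    push_cast
    field_simp
  have hsum := sum_Ioc_mul_eq_sum_sum f g N
  simp only [hfg] at hsum
  set A := ∑ n ∈ Ioc 0 N, chi n * (n : ℝ)⁻¹ with hA
  have hA23 : 2 / 3 ≤ A := two_thirds_le_sum_chi_div hN
  have hpsi : ∑ n ∈ Ioc 0 N, vonMangoldt n ≤ (Real.log 4 + 4) * N := by
    have := Chebyshev.psi_le_const_mul_self hN0.le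
    simpa [Chebyshev.psi] using this
  have hdiff : |A * ∑ n ∈ Ioc 0 N, f n - ∑ n ∈ Ioc 0 N, chi n * (Real.log n / n)| ≤
      Real.log 4 + 4 := by
    rw [hsum, mul_sum, ← sum_sub_distrib]
    refine (abs_sum_le_sum_abs _ _).trans ?_
    calc _ ≤ ∑ n ∈ Ioc 0 N, vonMangoldt n / N := by
          refine sum_le_sum fun n hn => ?_
          obtain ⟨hn0, hnN⟩ := mem_Ioc.1 hn
          have hn0' : (0 : ℝ) < n := by exact_mod_cast hn0
          have hsplit : A = ∑ m ∈ Ioc 0 (N / n), g m + ∑ m ∈ Ioc (N / n) N, g m :=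
            (Finset.sum_Ioc_consecutive _ (Nat.zero_le _) (Nat.div_le_self _ _)).symm
          have htail : |∑ m ∈ Ioc (N / n) N, g m| ≤ (((N / n + 1 : ℕ) : ℝ))⁻¹ :=
            abs_sum_chi_mul_le (g := fun m : ℕ => (m : ℝ)⁻¹) (Nat.div_le_self _ _)
              (fun m hm => by
                have : (0 : ℝ) < m := by exact_mod_cast (Nat.zero_lt_of_lt hm : 0 < m)
                gcongr; simp) (fun m hm => by positivity)
          have hfl : (((N / n + 1 : ℕ) : ℝ))⁻¹ ≤ n / N := by
            rw [← inv_div]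
            refine inv_anti₀ (by positivity) ?_
            rw [← Nat.floor_div_eq_div (K := ℝ)]
            push_cast
            exact (Nat.lt_floor_add_one _).le
          have hf : |f n| ≤ vonMangoldt n / n := by
            simp only [f, coe_mk, abs_div, abs_mul, abs_of_nonneg vonMangoldt_nonneg,
              Nat.abs_cast]
            gcongr
            exact mul_le_of_le_one_left vonMangoldt_nonneg (abs_chi_le_one n)
          rw [hsplit, show ∀ a b c : ℝ, (a + b) * c - c * a = c * b by intros; ring, abs_mul]
          calc _ ≤ vonMangoldt n / n * (n / N) :=
                mul_le_mul hf (htail.trans hfl) (abs_nonneg _)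
                  (div_nonneg vonMangoldt_nonneg hn0'.le)
            _ = _ := by field_simp
      _ ≤ _ := by
          rw [← sum_div, div_le_iff₀ hN0]
          exact hpsi
  have h1 : |A * ∑ n ∈ Ioc 0 N, f n| ≤ C + (Real.log 4 + 4) := by
    have h2 := hC N
    rw [abs_le] at *
    constructor <;> linarith [hdiff.1, hdiff.2]
  rw [abs_mul, abs_of_nonneg (by linarith)] at h1
  have h2 : 2 / 3 * |∑ n ∈ Ioc 0 N, f n| ≤ A * |∑ n ∈ Ioc 0 N, f n| := by gcongr
  have h3 : |∑ n ∈ Ioc 0 N, f n| ≤ 3 / 2 * (C + (Real.log 4 + 4)) := by linarith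
  exact h3

open Finset in
/-- The primes `p ≤ N` with `p ≡ 1 (mod 4)`. -/
noncomputable def splitPrimes (N : ℕ) : Finset ℕ :=
  (Ioc 0 N).filter fun p => p.Prime ∧ p % 4 = 1

theorem mem_splitPrimes {N p : ℕ} : p ∈ splitPrimes N ↔ p ≤ N ∧ p.Prime ∧ p % 4 = 1 := by
  simp only [splitPrimes, Finset.mem_filter, Finset.mem_Ioc]
  exact ⟨fun h => ⟨h.1.2, h.2⟩, fun h => ⟨⟨h.2.1.pos, h.1⟩, h.2⟩⟩

open ArithmeticFunction in
theorem summable_vonMangoldt_nonprime_div :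
    Summable fun n : ℕ => (if n.Prime then 0 else vonMangoldt n) / n := by
  have h := vonMangoldt.summable_residueClass_non_primes_div (q := 1) (a := 1)
  refine h.congr fun n => ?_
  have : vonMangoldt.residueClass (1 : ZMod 1) n = vonMangoldt n :=
    Set.indicator_of_mem (s := {n : ℕ | (n : ZMod 1) = 1}) (Subsingleton.elim (n : ZMod 1) 1) _
  rw [this]

open Finset ArithmeticFunction in
theorem sum_splitPrimes_log_div_sub_bounded :
    ∃ C : ℝ, 0 ≤ C ∧ ∀ N : ℕ, 1 ≤ N →
      |∑ p ∈ splitPrimes N, Real.log p / p - Real.log N / 2| ≤ C := by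
  obtain ⟨C₁, h₁⟩ := sum_vonMangoldt_div_sub_log_bounded
  obtain ⟨C₂, h₂⟩ := sum_chi_mul_vonMangoldt_div_bounded
  have hC₁ : 0 ≤ C₁ := (abs_nonneg _).trans (h₁ 1 le_rfl)
  have hC₂ : 0 ≤ C₂ := (abs_nonneg _).trans (h₂ 1)
  let np : ℕ → ℝ := fun n => (if n.Prime then 0 else vonMangoldt n) / n
  have hnp0 (n : ℕ) : 0 ≤ np n := by
    simp only [np]
    split_ifs
    · simp
    · exact div_nonneg vonMangoldt_nonneg (Nat.cast_nonneg _)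
  have hnps : Summable np := summable_vonMangoldt_nonprime_div
  have hnpt (N : ℕ) : ∑ n ∈ Ioc 0 N, np n ≤ ∑' n, np n := hnps.sum_le_tsum _ fun n _ => hnp0 n
  have ht0 : 0 ≤ ∑' n, np n := tsum_nonneg hnp0
  refine ⟨C₁ + C₂ + 2 * ∑' n, np n + 1, by positivity, fun N hN => ?_⟩
  have hpt (n : ℕ) (hn : n ≠ 0) :
      2 * (if n.Prime ∧ n % 4 = 1 then Real.log n / n else 0) ≤
        vonMangoldt n / n + chi n * vonMangoldt n / n ∧
      vonMangoldt n / n + chi n * vonMangoldt n / n ≤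
        2 * (if n.Prime ∧ n % 4 = 1 then Real.log n / n else 0) + 2 * np n +
          (if n = 2 then Real.log 2 / 2 else 0) := by
    have hchi := abs_le.1 (abs_chi_le_one n)
    have hv : 0 ≤ vonMangoldt n / n := div_nonneg vonMangoldt_nonneg (Nat.cast_nonneg _)
    have hl : 0 ≤ (if n = 2 then Real.log 2 / 2 else (0 : ℝ)) := by
      split_ifs <;> positivity
    have heq : vonMangoldt n / n + chi n * vonMangoldt n / n =
        (1 + chi n) * (vonMangoldt n / n) := by ring
    rw [heq]
    by_cases hp : n.Prime
    · have hnp : np n = 0 := by simp [np, hp]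
      rw [hnp, vonMangoldt_apply_prime hp, chi_eq]
      rcases hp.eq_two_or_odd with rfl | hodd
      · norm_num
        positivity
      · have h2 : n ≠ 2 := by rintro rfl; simp at hodd
        by_cases h4 : n % 4 = 1
        · simp [hp, h4, h2, hodd]
          norm_num
        · simp [h4, h2, hodd]
    · have hnp : np n = vonMangoldt n / n := by simp [np, hp]
      rw [hnp]
      simp only [hp, false_and, if_false]
      constructor <;> nlinarith
  have hsplit : ∑ p ∈ splitPrimes N, Real.log p / p =
      ∑ n ∈ Ioc 0 N, (if n.Prime ∧ n % 4 = 1 then Real.log n / n else 0) := by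
    rw [splitPrimes, sum_filter]
  have hlow := sum_le_sum fun n (hn : n ∈ Ioc 0 N) =>
    (hpt n (by have := (mem_Ioc.1 hn).1; omega)).1
  have hupp := sum_le_sum fun n (hn : n ∈ Ioc 0 N) =>
    (hpt n (by have := (mem_Ioc.1 hn).1; omega)).2
  simp only [sum_add_distrib, ← mul_sum, ← hsplit] at hlow hupp
  have htwo : ∑ n ∈ Ioc 0 N, (if n = 2 then Real.log 2 / 2 else (0 : ℝ)) ≤ 1 := by
    rw [Finset.sum_ite_eq']
    have := Real.log_two_lt_d9
    split_ifs <;> linarith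
  have h₁' := abs_le.1 (h₁ N hN)
  have h₂' := abs_le.1 (h₂ N)
  have := hnpt N
  rw [abs_le]
  constructor <;> linarith

theorem splitPrimes_subset {M N : ℕ} (h : M ≤ N) : splitPrimes M ⊆ splitPrimes N :=
  fun _ hp => mem_splitPrimes.2 ⟨(mem_splitPrimes.1 hp).1.trans h, (mem_splitPrimes.1 hp).2⟩

open Finset in
theorem sum_splitPrimes_succ (f : ℕ → ℝ) (N : ℕ) :
    ∑ p ∈ splitPrimes (N + 1), f p =
      ∑ p ∈ splitPrimes N, f p + if (N + 1).Prime ∧ (N + 1) % 4 = 1 then f (N + 1) else 0 := by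
  rw [splitPrimes, sum_filter, Finset.sum_Ioc_succ_top (Nat.zero_le N), splitPrimes, sum_filter]

open Finset in
theorem half_log_log_sub_le_sum_splitPrimes_inv :
    ∃ C : ℝ, ∀ N : ℕ, 2 ≤ N →
      Real.log (Real.log N) / 2 - C ≤ ∑ p ∈ splitPrimes N, (p : ℝ)⁻¹ := by
  obtain ⟨C, hC0, hC⟩ := sum_splitPrimes_log_div_sub_bounded
  let S : ℕ → ℝ := fun N => ∑ p ∈ splitPrimes N, Real.log p / p
  let D : ℝ := C + 1
  have hS (N : ℕ) (hN : 2 ≤ N) : Real.log ((N + 1 : ℕ) : ℝ) / 2 - D ≤ S N := by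
    have h1 := (abs_le.1 (hC N (by omega))).1
    have hN2 : (2 : ℝ) ≤ N := by exact_mod_cast hN
    have h2 : Real.log ((N + 1 : ℕ) : ℝ) ≤ Real.log 2 + Real.log N := by
      rw [← Real.log_mul (by norm_num) (by positivity)]
      refine Real.log_le_log (by positivity) ?_
      push_cast
      linarith
    have := Real.log_two_lt_d9
    simp only [S, D]
    linarith
  have key (N : ℕ) (hN : 2 ≤ N) :
      Real.log (Real.log N) / 2 + D / Real.log N -
          (Real.log (Real.log (2 : ℕ)) / 2 + D / Real.log (2 : ℕ)) ≤
        ∑ p ∈ splitPrimes N, (p : ℝ)⁻¹ - S N / Real.log N := by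
    induction N, hN using Nat.le_induction with
    | base =>
      have : splitPrimes 2 = ∅ := by
        ext p
        simp only [mem_splitPrimes, notMem_empty, iff_false]
        rintro ⟨h1, h2, h3⟩
        have := h2.two_le
        omega
      simp [S, this]
    | succ N hN ih =>
      have hu : 0 < Real.log (N : ℝ) := Real.log_pos (by exact_mod_cast (by omega : 1 < N))
      have huv : Real.log (N : ℝ) < Real.log ((N + 1 : ℕ) : ℝ) :=
        Real.log_lt_log (by positivity) (by push_cast; linarith)
      have hSN := hS N hN
      have hstep : ∑ p ∈ splitPrimes (N + 1), (p : ℝ)⁻¹ - S (N + 1) / Real.log ((N + 1 : ℕ) : ℝ) =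
          ∑ p ∈ splitPrimes N, (p : ℝ)⁻¹ - S N / Real.log ((N + 1 : ℕ) : ℝ) := by
        simp only [S]
        rw [sum_splitPrimes_succ (fun p => (p : ℝ)⁻¹) N,
          sum_splitPrimes_succ (fun p => Real.log p / p) N, add_div]
        have hv : Real.log ((N + 1 : ℕ) : ℝ) ≠ 0 := by linarith
        split_ifs
        · field_simp
          ring
        · simp
      rw [hstep]
      set u := Real.log (N : ℝ)
      set v := Real.log ((N + 1 : ℕ) : ℝ)
      have hv : 0 < v := hu.trans huv
      have hlog : Real.log v - Real.log u ≤ v / u - 1 := by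
        rw [← Real.log_div hv.ne' hu.ne']
        exact Real.log_le_sub_one_of_pos (by positivity)
      have hinv : 0 ≤ 1 / u - 1 / v := by
        have := one_div_le_one_div_of_le hu huv.le
        linarith
      have hmul : (v / 2 - D) * (1 / u - 1 / v) ≤ S N * (1 / u - 1 / v) := by gcongr
      have hexp : (v / 2 - D) * (1 / u - 1 / v) = (v / u - 1) / 2 - D / u + D / v := by
        field_simp
        ring
      have hexp2 : S N * (1 / u - 1 / v) = S N / u - S N / v := by ring
      rw [hexp, hexp2] at hmul
      linarith
  refine ⟨Real.log (Real.log (2 : ℕ)) / 2 + D / Real.log (2 : ℕ) + D / Real.log (2 : ℕ),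
    fun N hN => ?_⟩
  have h := key N hN
  have hl2 : 0 < Real.log ((2 : ℕ) : ℝ) := Real.log_pos (by norm_num)
  have hS0 : 0 ≤ S N := sum_nonneg fun p _ => by positivity
  have hlN : Real.log ((2 : ℕ) : ℝ) ≤ Real.log N :=
    Real.log_le_log (by norm_num) (by exact_mod_cast hN)
  have hD : 0 ≤ D := by positivity
  have : 0 ≤ S N / Real.log N := div_nonneg hS0 (by linarith)
  have : 0 ≤ D / Real.log N := div_nonneg hD (by linarith)
  have : 0 ≤ D / Real.log (2 : ℕ) := div_nonneg hD hl2.le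
  linarith

open Finset in
theorem sum_powerset_prod_mul_sum_le {ι : Type*} [DecidableEq ι] (P : Finset ι) {g h : ι → ℝ}
    (hg : ∀ i, 0 ≤ g i) (hh : ∀ i, 0 ≤ h i) :
    ∑ T ∈ P.powerset, (∏ i ∈ T, g i) * ∑ i ∈ T, h i ≤
      (∑ i ∈ P, g i * h i) * ∑ T ∈ P.powerset, ∏ i ∈ T, g i := by
  induction P using Finset.induction_on with
  | empty => simp
  | insert a P ha ih =>
    have hmem : ∀ T ∈ P.powerset, a ∉ T := fun T hT haT => ha (mem_powerset.1 hT haT)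
    rw [sum_powerset_insert ha, sum_powerset_insert ha, sum_insert ha]
    have e1 : ∑ T ∈ P.powerset, (∏ i ∈ insert a T, g i) * ∑ i ∈ insert a T, h i =
        g a * ∑ T ∈ P.powerset, (∏ i ∈ T, g i) * ∑ i ∈ T, h i +
          g a * h a * ∑ T ∈ P.powerset, ∏ i ∈ T, g i := by
      rw [mul_sum, mul_sum, ← sum_add_distrib]
      refine sum_congr rfl fun T hT => ?_
      rw [prod_insert (hmem T hT), sum_insert (hmem T hT)]
      ring
    have e2 : ∑ T ∈ P.powerset, ∏ i ∈ insert a T, g i =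
        g a * ∑ T ∈ P.powerset, ∏ i ∈ T, g i := by
      rw [mul_sum]
      exact sum_congr rfl fun T hT => prod_insert (hmem T hT)
    rw [e1, e2]
    have hA : 0 ≤ ∑ T ∈ P.powerset, ∏ i ∈ T, g i :=
      sum_nonneg fun T _ => prod_nonneg fun i _ => hg i
    have h1 := mul_le_mul_of_nonneg_left ih (hg a)
    have h2 : 0 ≤ g a * h a * (g a * ∑ T ∈ P.powerset, ∏ i ∈ T, g i) :=
      mul_nonneg (mul_nonneg (hg a) (hh a)) (mul_nonneg (hg a) hA)
    linarith

open Finset in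
theorem half_prod_one_add_le_sum_powerset_filter {ι : Type*} [DecidableEq ι] (P : Finset ι)
    {g h : ι → ℝ} (hg : ∀ i, 0 ≤ g i) (hh : ∀ i, 0 ≤ h i) {Y : ℝ} (hY : 0 < Y)
    (hP : ∑ i ∈ P, g i * h i ≤ Y / 2) :
    (∏ i ∈ P, (1 + g i)) / 2 ≤ ∑ T ∈ P.powerset with ∑ i ∈ T, h i ≤ Y, ∏ i ∈ T, g i := by
  have hF (T : Finset ι) : 0 ≤ ∏ i ∈ T, g i := prod_nonneg fun i _ => hg i
  have hA : 0 ≤ ∑ T ∈ P.powerset, ∏ i ∈ T, g i := sum_nonneg fun T _ => hF T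
  have hbad : Y * ∑ T ∈ P.powerset with ¬ ∑ i ∈ T, h i ≤ Y, ∏ i ∈ T, g i ≤
      ∑ T ∈ P.powerset, (∏ i ∈ T, g i) * ∑ i ∈ T, h i := by
    rw [mul_sum]
    calc _ ≤ ∑ T ∈ P.powerset with ¬ ∑ i ∈ T, h i ≤ Y, (∏ i ∈ T, g i) * ∑ i ∈ T, h i := by
          refine sum_le_sum fun T hT => ?_
          rw [mul_comm]
          exact mul_le_mul_of_nonneg_left (not_le.1 (mem_filter.1 hT).2).le (hF T)
      _ ≤ _ := sum_le_sum_of_subset_of_nonneg (filter_subset _ _) fun T _ _ =>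
          mul_nonneg (hF T) (sum_nonneg fun i _ => hh i)
  have h1 := sum_powerset_prod_mul_sum_le P hg hh
  have h2 := mul_le_mul_of_nonneg_right hP hA
  have h3 := sum_filter_add_sum_filter_not P.powerset (fun T => ∑ i ∈ T, h i ≤ Y)
    (fun T => ∏ i ∈ T, g i)
  rw [prod_one_add, ← h3]
  rw [← h3] at h2
  have h4 : ∑ T ∈ P.powerset with ¬ ∑ i ∈ T, h i ≤ Y, ∏ i ∈ T, g i ≤
      (∑ T ∈ P.powerset with ∑ i ∈ T, h i ≤ Y, ∏ i ∈ T, g i +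
        ∑ T ∈ P.powerset with ¬ ∑ i ∈ T, h i ≤ Y, ∏ i ∈ T, g i) / 2 := by
    refine le_of_mul_le_mul_left ?_ hY
    rw [← h3] at h1
    linarith
  linarith

theorem exp_sub_sq_le_one_add {u : ℝ} (hu : 0 ≤ u) : Real.exp (u - u ^ 2) ≤ 1 + u := by
  rw [← Real.le_log_iff_exp_le (by positivity)]
  have h := Real.one_sub_inv_le_log_of_pos (show 0 < 1 + u by positivity)
  refine le_trans ?_ h
  have h1 : 1 - (1 + u)⁻¹ - (u - u ^ 2) = u ^ 3 / (1 + u) := by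
    field_simp
    ring
  have h2 : 0 ≤ u ^ 3 / (1 + u) := by positivity
  linarith

open Finset in
theorem log_pow_le_prod_splitPrimes (K : ℕ) :
    ∃ c : ℝ, 0 < c ∧ ∀ N : ℕ, 2 ≤ N →
      c * Real.log N ^ K ≤ ∏ p ∈ splitPrimes N, (1 + 2 * K / (p : ℝ)) := by
  obtain ⟨C, hC⟩ := half_log_log_sub_le_sum_splitPrimes_inv
  let B : ℝ := ∑' n : ℕ, 1 / (n : ℝ) ^ 2
  refine ⟨Real.exp (-(2 * K * C) - (2 * K) ^ 2 * B), Real.exp_pos _, fun N hN => ?_⟩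
  have hl : 0 < Real.log N := Real.log_pos (by exact_mod_cast (by omega : 1 < N))
  have hsq : ∑ p ∈ splitPrimes N, 1 / (p : ℝ) ^ 2 ≤ B :=
    (Real.summable_one_div_nat_pow.2 one_lt_two).sum_le_tsum _ fun n _ => by positivity
  have hpow : Real.log N ^ K = Real.exp (K * Real.log (Real.log N)) := by
    rw [← Real.log_pow, Real.exp_log (by positivity)]
  calc _ = Real.exp (-(2 * K * C) - (2 * K) ^ 2 * B + K * Real.log (Real.log N)) := by
        rw [hpow, ← Real.exp_add]
    _ ≤ Real.exp (∑ p ∈ splitPrimes N, (2 * K / (p : ℝ) - (2 * K / (p : ℝ)) ^ 2)) := by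
        rw [Real.exp_le_exp]
        have e : ∑ p ∈ splitPrimes N, (2 * K / (p : ℝ) - (2 * K / (p : ℝ)) ^ 2) =
            2 * K * ∑ p ∈ splitPrimes N, (p : ℝ)⁻¹ -
              (2 * K) ^ 2 * ∑ p ∈ splitPrimes N, 1 / (p : ℝ) ^ 2 := by
          rw [sum_sub_distrib, mul_sum, mul_sum]
          congr 1
          exact sum_congr rfl fun p _ => by rw [div_pow]; ring
        rw [e]
        have h1 := mul_le_mul_of_nonneg_left (hC N hN) (show (0 : ℝ) ≤ 2 * K by positivity)
        have h2 := mul_le_mul_of_nonneg_left hsq (show (0 : ℝ) ≤ (2 * K) ^ 2 by positivity)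
        linarith
    _ = ∏ p ∈ splitPrimes N, Real.exp (2 * K / (p : ℝ) - (2 * K / (p : ℝ)) ^ 2) :=
        Real.exp_sum _ _
    _ ≤ _ := prod_le_prod (fun p _ => (Real.exp_pos _).le) fun p _ =>
        exp_sub_sq_le_one_add (by positivity)

theorem half_le_floor {y : ℝ} (hy : 1 ≤ y) : y / 2 ≤ ⌊y⌋₊ := by
  have h1 := Nat.lt_floor_add_one y
  have h2 : (1 : ℝ) ≤ ⌊y⌋₊ := by exact_mod_cast Nat.le_floor (by exact_mod_cast hy)
  linarith

theorem log_floor_rpow_bounds {x a : ℝ} (hx : 1 ≤ x) (ha : 0 ≤ a) :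
    a * Real.log x - 1 ≤ Real.log ⌊x ^ a⌋₊ ∧ Real.log ⌊x ^ a⌋₊ ≤ a * Real.log x := by
  have h1 : 1 ≤ x ^ a := Real.one_le_rpow hx ha
  have h2 : (0 : ℝ) < ⌊x ^ a⌋₊ := by have := half_le_floor h1; linarith
  rw [← Real.log_rpow (by linarith)]
  constructor
  · have h3 := Real.log_le_log (by positivity) (half_le_floor h1)
    rw [Real.log_div (by positivity) two_ne_zero] at h3
    have := Real.log_two_lt_d9
    linarith
  · exact Real.log_le_log h2 (Nat.floor_le (by positivity))

open Finset Filter in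
theorem exists_le_sum_splitPrimes_sdiff_inv {a b : ℝ} (ha : 0 < a) (hab : a < b) :
    ∃ c : ℝ, 0 < c ∧ ∀ᶠ x : ℝ in atTop,
      c ≤ ∑ p ∈ splitPrimes ⌊x ^ b⌋₊ \ splitPrimes ⌊x ^ a⌋₊, (p : ℝ)⁻¹ := by
  obtain ⟨C, hC0, hC⟩ := sum_splitPrimes_log_div_sub_bounded
  have hb : 0 < b := ha.trans hab
  have hba : 0 < b - a := sub_pos.2 hab
  refine ⟨(b - a) / (4 * b), by positivity, ?_⟩
  filter_upwards [eventually_ge_atTop 1,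
    Real.tendsto_log_atTop.eventually_ge_atTop ((2 * C + 1) * 4 / (b - a)),
    Real.tendsto_log_atTop.eventually_ge_atTop 1] with x hx1 hx2 hx3
  have hxa : 1 ≤ x ^ a := Real.one_le_rpow hx1 ha.le
  have hxb : 1 ≤ x ^ b := Real.one_le_rpow hx1 hb.le
  have hmono : splitPrimes ⌊x ^ a⌋₊ ⊆ splitPrimes ⌊x ^ b⌋₊ :=
    splitPrimes_subset (Nat.floor_le_floor (Real.rpow_le_rpow_of_exponent_le hx1 hab.le))
  have hA := (abs_le.1 (hC ⌊x ^ a⌋₊ (Nat.le_floor (by exact_mod_cast hxa)))).2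
  have hB := (abs_le.1 (hC ⌊x ^ b⌋₊ (Nat.le_floor (by exact_mod_cast hxb)))).1
  have hla := (log_floor_rpow_bounds hx1 ha.le).2
  have hlb := (log_floor_rpow_bounds hx1 hb.le).1
  have hsub := sum_sdiff hmono (f := fun p : ℕ => Real.log p / p)
  have hterm : ∑ p ∈ splitPrimes ⌊x ^ b⌋₊ \ splitPrimes ⌊x ^ a⌋₊, Real.log p / (p : ℝ) ≤
      b * Real.log x * ∑ p ∈ splitPrimes ⌊x ^ b⌋₊ \ splitPrimes ⌊x ^ a⌋₊, (p : ℝ)⁻¹ := by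
    rw [mul_sum]
    refine sum_le_sum fun p hp => ?_
    obtain ⟨hpb, hp', -⟩ := mem_splitPrimes.1 (mem_sdiff.1 hp).1
    have h1 : Real.log p ≤ b * Real.log x :=
      (Real.log_le_log (by exact_mod_cast hp'.pos) (by exact_mod_cast hpb)).trans
        (log_floor_rpow_bounds hx1 hb.le).2
    rw [div_eq_mul_inv]
    gcongr
  rw [div_le_iff₀ hba] at hx2
  rw [div_le_iff₀ (by positivity)]
  refine le_of_mul_le_mul_right ?_ (show 0 < Real.log x by linarith)
  nlinarith

/-- The representations of `n` as an ordered sum of two integer squares. -/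
def sqReps (n : ℕ) : Set (ℤ × ℤ) := {p | p.1 ^ 2 + p.2 ^ 2 = n}

theorem mem_sqReps {n : ℕ} {a b : ℤ} : (a, b) ∈ sqReps n ↔ a ^ 2 + b ^ 2 = n := Iff.rfl

theorem finite_sqReps (n : ℕ) : (sqReps n).Finite := by
  refine ((Set.finite_Icc (-(n : ℤ)) n).prod (Set.finite_Icc (-(n : ℤ)) n)).subset ?_
  rintro ⟨a, b⟩ h
  rw [mem_sqReps] at h
  simp only [Set.mem_prod, Set.mem_Icc]
  refine ⟨⟨?_, ?_⟩, ?_, ?_⟩ <;> nlinarith [sq_nonneg a, sq_nonneg b]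

theorem ncard_sqReps_le_four_mul_r0 {n : ℕ} (hn : n ≠ 0) : (sqReps n).ncard ≤ 4 * r0 n := by
  let F : Set (ℤ × ℤ) := {p | (n : ℤ) = p.1 ^ 2 + p.2 ^ 2 ∧ 0 ≤ p.1 ∧ 0 < p.2}
  have hF (a b : ℤ) : (a, b) ∈ F ↔ (n : ℤ) = a ^ 2 + b ^ 2 ∧ 0 ≤ a ∧ 0 < b := Iff.rfl
  have hr : r0 n = F.ncard := rfl
  have hFfin : F.Finite := (finite_sqReps n).subset fun p hp => hp.1.symm
  let rot : ℤ × ℤ → ℤ × ℤ := fun p => (-p.2, p.1)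
  have hcover : sqReps n ⊆ (F ∪ rot '' F) ∪ (rot '' (rot '' F) ∪ rot '' (rot '' (rot '' F))) := by
    rintro ⟨a, b⟩ h
    rw [mem_sqReps] at h
    have hne : a ≠ 0 ∨ b ≠ 0 := by
      by_contra! h0
      simp only [h0.1, h0.2] at h
      norm_num at h
      exact hn (by exact_mod_cast h.symm)
    by_cases h1 : 0 ≤ a ∧ 0 < b
    · exact Or.inl (Or.inl ((hF _ _).2 ⟨h.symm, h1⟩))
    by_cases h2 : a < 0 ∧ 0 ≤ b
    · refine Or.inl (Or.inr ⟨(b, -a), (hF _ _).2 ⟨?_, h2.2, by omega⟩, by simp [rot]⟩)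
      rw [← h]; ring
    by_cases h3 : a ≤ 0 ∧ b < 0
    · refine Or.inr (Or.inl ⟨(b, -a), ⟨(-a, -b), (hF _ _).2 ⟨?_, by omega, by omega⟩,
        by simp [rot]⟩, by simp [rot]⟩)
      rw [← h]; ring
    · refine Or.inr (Or.inr ⟨(b, -a), ⟨(-a, -b), ⟨(-b, a), (hF _ _).2 ⟨?_, by omega, by omega⟩,
        by simp [rot]⟩, by simp [rot]⟩, by simp [rot]⟩)
      rw [← h]; ring
  have hle (A : Set (ℤ × ℤ)) (hA : A.Finite) : (rot '' A).ncard ≤ A.ncard := Set.ncard_image_le hA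
  have hfin := ((hFfin.union (hFfin.image rot)).union
    (((hFfin.image rot).image rot).union (((hFfin.image rot).image rot).image rot)))
  have h1 := Set.ncard_le_ncard hcover hfin
  have h2 := Set.ncard_union_le (F ∪ rot '' F)
    (rot '' (rot '' F) ∪ rot '' (rot '' (rot '' F)))
  have h3 := Set.ncard_union_le F (rot '' F)
  have h4 := Set.ncard_union_le (rot '' (rot '' F)) (rot '' (rot '' (rot '' F)))
  have h5 := hle F hFfin
  have h6 := hle _ (hFfin.image rot)
  have h7 := hle _ ((hFfin.image rot).image rot)
  omega

theorem two_mul_ncard_sqReps_le {p N : ℕ} (hp : p.Prime) (hp4 : p % 4 = 1) (hpN : ¬ p ∣ N) :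
    2 * (sqReps N).ncard ≤ (sqReps (p * N)).ncard := by
  have := Fact.mk hp
  obtain ⟨u', v', huv'⟩ := Nat.Prime.sq_add_sq (p := p) (by omega)
  obtain ⟨u, hu⟩ : ∃ u : ℤ, u = u' := ⟨_, rfl⟩
  obtain ⟨v, hv⟩ : ∃ v : ℤ, v = v' := ⟨_, rfl⟩
  have huv : u ^ 2 + v ^ 2 = p := by rw [hu, hv]; exact_mod_cast huv'
  have hp0 : (p : ℤ) ≠ 0 := by exact_mod_cast hp.ne_zero
  have hpI : Prime (p : ℤ) := Nat.prime_iff_prime_int.1 hp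
  have hcop : IsCoprime u v := by
    rw [Int.isCoprime_iff_gcd_eq_one]
    have h1 : ((Int.gcd u v : ℤ)) * (Int.gcd u v : ℤ) ∣ p := by
      rw [← huv, ← sq]
      exact dvd_add (pow_dvd_pow_of_dvd (Int.gcd_dvd_left u v) 2)
        (pow_dvd_pow_of_dvd (Int.gcd_dvd_right u v) 2)
    simpa [Int.isUnit_iff_natAbs_eq] using hpI.squarefree _ h1
  let φ : ℤ × ℤ → ℤ × ℤ := fun z => (z.1 * u - z.2 * v, z.1 * v + z.2 * u)
  let ψ : ℤ × ℤ → ℤ × ℤ := fun z => (z.1 * u + z.2 * v, -z.1 * v + z.2 * u)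
  have hφ : Function.Injective φ := by
    rintro ⟨a, b⟩ ⟨a', b'⟩ h
    simp only [φ, Prod.mk.injEq] at h ⊢
    obtain ⟨h1, h2⟩ := h
    constructor <;> refine mul_right_cancel₀ hp0 ?_ <;> rw [← huv]
    · linear_combination u * h1 + v * h2
    · linear_combination u * h2 - v * h1
  have hψ : Function.Injective ψ := by
    rintro ⟨a, b⟩ ⟨a', b'⟩ h
    simp only [ψ, Prod.mk.injEq] at h ⊢
    obtain ⟨h1, h2⟩ := h
    constructor <;> refine mul_right_cancel₀ hp0 ?_ <;> rw [← huv]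
    · linear_combination u * h1 - v * h2
    · linear_combination u * h2 + v * h1
  have hdisj : Disjoint (φ '' sqReps N) (ψ '' sqReps N) := by
    rw [Set.disjoint_left]
    rintro _ ⟨⟨a, b⟩, hz, rfl⟩ ⟨⟨a', b'⟩, -, h⟩
    rw [mem_sqReps] at hz
    simp only [φ, ψ, Prod.mk.injEq] at h
    obtain ⟨h1, h2⟩ := h
    obtain ⟨t, ht⟩ : u ∣ b + b' := hcop.dvd_of_dvd_mul_right ⟨a - a', by linear_combination h1⟩
    obtain ⟨s, hs⟩ : u ∣ a + a' := hcop.dvd_of_dvd_mul_right ⟨b' - b, by linear_combination -h2⟩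
    have hu0 : u ≠ 0 := by
      rintro rfl
      have hsq : v * v ∣ (p : ℤ) := ⟨1, by linear_combination -huv⟩
      have h3 := Int.isUnit_iff.1 (hpI.squarefree v hsq)
      have h4 := hp.one_lt
      have h5 : (1 : ℤ) < p := by exact_mod_cast h4
      rcases h3 with h3 | h3 <;> rw [h3] at huv <;> norm_num at huv <;> omega
    have ha : a - a' = v * t := mul_right_cancel₀ hu0 (by linear_combination v * ht - h1)
    have hb : b' - b = v * s := mul_right_cancel₀ hu0 (by linear_combination v * hs + h2)
    have h4N : (p : ℤ) ∣ 4 * N := by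
      refine ⟨s ^ 2 + t ^ 2, ?_⟩
      have h2a : 2 * a = u * s + v * t := by linear_combination hs + ha
      have h2b : 2 * b = u * t - v * s := by linear_combination ht - hb
      rw [← hz, ← huv]
      linear_combination (2 * a + (u * s + v * t)) * h2a + (2 * b + (u * t - v * s)) * h2b
    have h4N' : p ∣ 2 * 2 * N := by exact_mod_cast h4N
    have hp2 : ¬ p ∣ 2 := fun h => by
      have := (Nat.prime_dvd_prime_iff_eq hp Nat.prime_two).1 h
      omega
    rcases hp.dvd_mul.1 h4N' with h | h
    · rcases hp.dvd_mul.1 h with h | h <;> exact hp2 h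
    · exact hpN h
  have hsub : φ '' sqReps N ∪ ψ '' sqReps N ⊆ sqReps (p * N) := by
    rintro _ (⟨⟨a, b⟩, hz, rfl⟩ | ⟨⟨a, b⟩, hz, rfl⟩) <;> rw [mem_sqReps] at hz ⊢ <;>
      push_cast <;> rw [← hz, ← huv] <;> ring
  calc 2 * (sqReps N).ncard = (φ '' sqReps N ∪ ψ '' sqReps N).ncard := by
        rw [Set.ncard_union_eq hdisj ((finite_sqReps N).image _) ((finite_sqReps N).image _),
          Set.ncard_image_of_injective _ hφ, Set.ncard_image_of_injective _ hψ]
        ring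
    _ ≤ _ := Set.ncard_le_ncard hsub (finite_sqReps _)

theorem not_dvd_two_mul_prod {p : ℕ} {T : Finset ℕ} (hp : p.Prime) (hp4 : p % 4 = 1)
    (hT : ∀ q ∈ T, q.Prime) (hpT : p ∉ T) : ¬ p ∣ 2 * ∏ q ∈ T, q := by
  intro h
  rcases hp.dvd_mul.1 h with h | h
  · have := (Nat.prime_dvd_prime_iff_eq hp Nat.prime_two).1 h
    omega
  · obtain ⟨q, hq, hpq⟩ := (hp.prime.dvd_finsetProd_iff _).1 h
    exact hpT ((Nat.prime_dvd_prime_iff_eq hp (hT q hq)).1 hpq ▸ hq)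

theorem two_pow_card_le_r0 {T : Finset ℕ} (hT : ∀ p ∈ T, p.Prime ∧ p % 4 = 1) :
    2 ^ T.card ≤ r0 (2 * ∏ p ∈ T, p) := by
  have key : 4 * 2 ^ T.card ≤ (sqReps (2 * ∏ p ∈ T, p)).ncard := by
    induction T using Finset.induction_on with
    | empty =>
      have hsub : ((({(1, 1), (1, -1), (-1, 1), (-1, -1)} : Finset (ℤ × ℤ))) : Set (ℤ × ℤ)) ⊆
          sqReps 2 := by
        intro z hz
        simp only [Finset.coe_insert, Finset.coe_singleton, Set.mem_insert_iff,
          Set.mem_singleton_iff] at hz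
        rcases hz with rfl | rfl | rfl | rfl <;> rw [mem_sqReps] <;> norm_num
      have h := Set.ncard_le_ncard hsub (finite_sqReps 2)
      rw [Set.ncard_coe_finset] at h
      simpa using h
    | insert p T hpT ih =>
      have hp := hT p (Finset.mem_insert_self _ _)
      have hT' : ∀ q ∈ T, q.Prime ∧ q % 4 = 1 := fun q hq => hT q (Finset.mem_insert_of_mem hq)
      have h1 := two_mul_ncard_sqReps_le hp.1 hp.2
        (not_dvd_two_mul_prod hp.1 hp.2 (fun q hq => (hT' q hq).1) hpT)
      have h2 := ih hT'
      rw [Finset.card_insert_of_notMem hpT, Finset.prod_insert hpT, mul_left_comm, pow_succ]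
      omega
  have h0 : 2 * ∏ p ∈ T, p ≠ 0 :=
    mul_ne_zero two_ne_zero (Finset.prod_ne_zero_iff.2 fun p hp => (hT p hp).1.ne_zero)
  have := ncard_sqReps_le_four_mul_r0 h0
  omega

theorem squarefree_two_mul_prod {T : Finset ℕ} (hT : ∀ p ∈ T, p.Prime ∧ p % 4 = 1) :
    Squarefree (2 * ∏ p ∈ T, p) := by
  induction T using Finset.induction_on with
  | empty => simpa using Nat.prime_two.prime.squarefree
  | insert p T hpT ih =>
    have hp := hT p (Finset.mem_insert_self _ _)
    have hT' : ∀ q ∈ T, q.Prime ∧ q % 4 = 1 := fun q hq => hT q (Finset.mem_insert_of_mem hq)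
    rw [Finset.prod_insert hpT, mul_left_comm, Nat.squarefree_mul_iff]
    exact ⟨(Nat.Prime.coprime_iff_not_dvd hp.1).2
      (not_dvd_two_mul_prod hp.1 hp.2 (fun q hq => (hT' q hq).1) hpT),
      hp.1.prime.squarefree, ih hT'⟩

open Finset in
theorem prod_div_mul_inv_le_r0_term (k : ℕ) {T : Finset ℕ} {q : ℕ} (hqT : q ∉ T)
    (hT : ∀ p ∈ insert q T, p.Prime ∧ p % 4 = 1) :
    (∏ p ∈ T, 2 ^ k / (p : ℝ)) * (q : ℝ)⁻¹ / 2 ≤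
      (r0 (2 * ∏ p ∈ insert q T, p) : ℝ) ^ k / ((2 * ∏ p ∈ insert q T, p : ℕ) : ℝ) := by
  have h1 : (2 : ℝ) ^ T.card ≤ r0 (2 * ∏ p ∈ insert q T, p) := by
    refine le_trans ?_ (Nat.cast_le.2 (two_pow_card_le_r0 hT))
    push_cast
    exact pow_le_pow_right₀ one_le_two (card_le_card (subset_insert _ _))
  have h2 : (∏ p ∈ T, 2 ^ k / (p : ℝ)) * (q : ℝ)⁻¹ / 2 =
      ((2 : ℝ) ^ T.card) ^ k / ((2 * ∏ p ∈ insert q T, p : ℕ) : ℝ) := by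
    rw [prod_insert hqT, prod_div_distrib, prod_const, ← pow_mul, ← pow_mul, mul_comm k]
    push_cast
    rw [div_mul_eq_mul_div, div_div, ← div_eq_mul_inv, div_div]
    congr 1
    ring
  rw [h2]
  gcongr

open Finset in
theorem injOn_two_mul_prod_insert {P Q : Finset ℕ} (hP : ∀ p ∈ P, p.Prime) (hQ : ∀ q ∈ Q, q.Prime)
    (hPQ : Disjoint P Q) :
    Set.InjOn (fun t : Finset ℕ × ℕ => 2 * ∏ p ∈ insert t.2 t.1, p)
      (P.powerset ×ˢ Q : Finset (Finset ℕ × ℕ)) := by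
  rintro ⟨T, q⟩ ht ⟨T', q'⟩ ht' h
  obtain ⟨hT, hq⟩ := mem_product.1 (mem_coe.1 ht)
  obtain ⟨hT', hq'⟩ := mem_product.1 (mem_coe.1 ht')
  simp only [mem_powerset] at hT hT' hq hq'
  have hprime (T : Finset ℕ) (q : ℕ) (hT : T ⊆ P) (hq : q ∈ Q) : ∀ p ∈ insert q T, p.Prime := by
    intro p hp
    rcases mem_insert.1 hp with rfl | hp
    · exact hQ _ hq
    · exact hP _ (hT hp)
  have hU : insert q T = insert q' T' := by
    have h1 := congrArg Nat.primeFactors (Nat.eq_of_mul_eq_mul_left two_pos h)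
    rwa [Nat.primeFactors_prod (hprime T q hT hq), Nat.primeFactors_prod (hprime T' q' hT' hq')]
      at h1
  have hnot (T : Finset ℕ) (q : ℕ) (hT : T ⊆ P) (hq : q ∈ Q) : q ∉ T :=
    fun h => disjoint_left.1 hPQ (hT h) hq
  have hqq : q = q' := by
    have : q ∈ insert q' T' := hU ▸ mem_insert_self q T
    exact (mem_insert.1 this).resolve_right (hnot T' q hT' hq)
  subst hqq
  have hTT : T = T' := by
    rw [← erase_insert (hnot T q hT hq), hU, erase_insert (hnot T' q hT' hq)]
  rw [hTT]

open Finset in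
theorem sum_filter_mul_sum_inv_le (k : ℕ) {P Q : Finset ℕ} (hP : ∀ p ∈ P, p.Prime ∧ p % 4 = 1)
    (hQ : ∀ q ∈ Q, q.Prime ∧ q % 4 = 1) (hPQ : Disjoint P Q) {x y z Y : ℝ}
    (hQz : ∀ q ∈ Q, z ≤ q) (hQy : ∀ q ∈ Q, (q : ℝ) ≤ y) (hx : 2 * (Real.exp Y * y) ≤ x) :
    (∑ T ∈ P.powerset with ∑ p ∈ T, Real.log (p : ℕ) ≤ Y, ∏ p ∈ T, 2 ^ k / (p : ℝ)) *
        (∑ q ∈ Q, (q : ℝ)⁻¹) / 2 ≤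
      ∑ N ∈ Icc 1 ⌊x⌋₊, (if z ≤ (N : ℝ) ∧ 2 ∣ N ∧ Squarefree N
        then (r0 N : ℝ) ^ k / (N : ℝ) else 0) := by
  set G : ℕ → ℝ := fun N => if z ≤ (N : ℝ) ∧ 2 ∣ N ∧ Squarefree N
    then (r0 N : ℝ) ^ k / (N : ℝ) else 0 with hG
  have hG0 (N : ℕ) : 0 ≤ G N := by
    simp only [hG]
    split_ifs <;> positivity
  set I : Finset (Finset ℕ × ℕ) := {T ∈ P.powerset | ∑ p ∈ T, Real.log (p : ℕ) ≤ Y} ×ˢ Q with hI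
  let e : Finset ℕ × ℕ → ℕ := fun t => 2 * ∏ p ∈ insert t.2 t.1, p
  have hinj : Set.InjOn e I :=
    (injOn_two_mul_prod_insert (fun p hp => (hP p hp).1) (fun q hq => (hQ q hq).1) hPQ).mono
      (coe_subset.2 (product_subset_product_left (filter_subset _ _)))
  have hmem {T : Finset ℕ} {q : ℕ} (ht : (T, q) ∈ I) :
      T ⊆ P ∧ ∑ p ∈ T, Real.log p ≤ Y ∧ q ∈ Q ∧ q ∉ T ∧
        ∀ p ∈ insert q T, p.Prime ∧ p % 4 = 1 := by
    obtain ⟨h1, hq⟩ := mem_product.1 ht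
    obtain ⟨h1, h2⟩ := mem_filter.1 h1
    have hTP := mem_powerset.1 h1
    refine ⟨hTP, h2, hq, fun h => disjoint_left.1 hPQ (hTP h) hq, fun p hp => ?_⟩
    rcases mem_insert.1 hp with rfl | hp
    · exact hQ _ hq
    · exact hP _ (hTP hp)
  calc _ = ∑ t ∈ I, (∏ p ∈ t.1, 2 ^ k / (p : ℝ)) * (t.2 : ℝ)⁻¹ / 2 := by
        rw [sum_mul_sum, ← sum_product', sum_div]
    _ ≤ ∑ t ∈ I, G (e t) := by
        refine sum_le_sum fun ⟨T, q⟩ ht => ?_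
        obtain ⟨hTP, hTY, hq, hqT, hpr⟩ := hmem ht
        have hz : z ≤ (e (T, q) : ℝ) := by
          refine (hQz q hq).trans (Nat.cast_le.2 ?_)
          have hdvd : q ∣ e (T, q) := (dvd_prod_of_mem _ (mem_insert_self q T)).mul_left 2
          exact Nat.le_of_dvd (Nat.pos_of_ne_zero (squarefree_two_mul_prod hpr).ne_zero) hdvd
        have hcond : z ≤ (e (T, q) : ℝ) ∧ 2 ∣ e (T, q) ∧ Squarefree (e (T, q)) :=
          ⟨hz, dvd_mul_right _ _, squarefree_two_mul_prod hpr⟩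
        simp only [hG]
        rw [if_pos hcond]
        exact prod_div_mul_inv_le_r0_term k hqT hpr
    _ = ∑ N ∈ I.image e, G N := (sum_image hinj).symm
    _ ≤ ∑ N ∈ Icc 1 ⌊x⌋₊, G N := by
        refine sum_le_sum_of_subset_of_nonneg ?_ fun N _ _ => hG0 N
        intro N hN
        obtain ⟨⟨T, q⟩, ht, rfl⟩ := mem_image.1 hN
        obtain ⟨hTP, hTY, hq, hqT, hpr⟩ := hmem ht
        refine mem_Icc.2 ⟨Nat.pos_of_ne_zero (squarefree_two_mul_prod hpr).ne_zero,
          Nat.le_floor ?_⟩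
        have hprod : ((∏ p ∈ T, p : ℕ) : ℝ) ≤ Real.exp Y := by
          have hpos : (0 : ℝ) < (∏ p ∈ T, p : ℕ) := by
            exact_mod_cast prod_pos fun p hp => (hpr p (mem_insert_of_mem hp)).1.pos
          rw [← Real.log_le_iff_le_exp hpos, Nat.cast_prod, Real.log_prod]
          · exact hTY
          · intro p hp
            exact_mod_cast (hpr p (mem_insert_of_mem hp)).1.ne_zero
        refine le_trans ?_ hx
        simp only [e]
        rw [prod_insert hqT]
        push_cast at hprod ⊢
        rw [mul_comm (q : ℝ)]
        gcongr
        exact hQy q hq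

theorem squarefree_r0_lower_bound (k : ℕ) (hk : 1 ≤ k) (δ : ℝ)
    (hδ0 : 0 < δ) (hδ1 : δ < 1) (C : ℝ) (hC : 0 < C) :
    ∃ c : ℝ, 0 < c ∧ ∃ x₀ : ℝ, ∀ x : ℝ, x₀ ≤ x → ∀ z : ℝ, z ≤ C * x ^ δ →
      c * Real.log x ^ (2 ^ (k - 1)) ≤
        ∑ N ∈ Finset.Icc 1 ⌊x⌋₊,
          (if z ≤ (N : ℝ) ∧ 2 ∣ N ∧ Squarefree N
            then (r0 N : ℝ) ^ k / (N : ℝ) else 0) := by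
  obtain ⟨η, hη⟩ : ∃ η : ℝ, η = (1 - δ) / 4 := ⟨_, rfl⟩
  have hη0 : 0 < η := by linarith
  obtain ⟨K, hK⟩ : ∃ K : ℕ, K = 2 ^ (k - 1) := ⟨_, rfl⟩
  have hKpos : (0 : ℝ) < K := by rw [hK]; positivity
  have hK1 : (1 : ℝ) ≤ K := by rw [hK]; exact_mod_cast Nat.one_le_two_pow
  have h2k : (2 : ℝ) ^ k = 2 * K := by
    rw [hK]
    push_cast
    rw [← pow_succ', Nat.sub_add_cancel hk]
  obtain ⟨θ, hθ⟩ : ∃ θ : ℝ, θ = η / (4 * K) := ⟨_, rfl⟩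
  have hθ0 : 0 < θ := by rw [hθ]; positivity
  have hθη : θ ≤ η := by
    rw [hθ]
    exact div_le_self hη0.le (by linarith)
  have hKθ : K * θ = η / 4 := by
    rw [hθ]
    field_simp
  obtain ⟨M, hM0, hM⟩ := sum_splitPrimes_log_div_sub_bounded
  obtain ⟨c₁, hc₁, hprod⟩ := log_pow_le_prod_splitPrimes K
  obtain ⟨c₂, hc₂, hinv⟩ := exists_le_sum_splitPrimes_sdiff_inv (a := δ + η) (b := δ + 2 * η)
    (by linarith) (by linarith)
  refine ⟨c₁ * (θ / 2) ^ K / 2 * c₂ / 2, by positivity, ?_⟩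
  rw [← hK]
  suffices h : ∀ᶠ x : ℝ in Filter.atTop, ∀ z : ℝ, z ≤ C * x ^ δ →
      c₁ * (θ / 2) ^ K / 2 * c₂ / 2 * Real.log x ^ K ≤
        ∑ N ∈ Finset.Icc 1 ⌊x⌋₊,
          (if z ≤ (N : ℝ) ∧ 2 ∣ N ∧ Squarefree N
            then (r0 N : ℝ) ^ k / (N : ℝ) else 0) from Filter.eventually_atTop.1 h
  filter_upwards [hinv, Filter.eventually_ge_atTop 1,
    (tendsto_rpow_atTop hη0).eventually_ge_atTop C,
    (tendsto_rpow_atTop hη0).eventually_ge_atTop 2,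
    (tendsto_rpow_atTop hθ0).eventually_ge_atTop 2,
    Real.tendsto_log_atTop.eventually_ge_atTop 1,
    Real.tendsto_log_atTop.eventually_ge_atTop (2 / θ),
    Real.tendsto_log_atTop.eventually_ge_atTop (8 * K * M / η)]
    with x hinv hx1 hxC hx2 hxθ hlog1 hlogθ hlogM z hz
  have hx0 : 0 < x := by linarith
  have hw2 : 2 ≤ ⌊x ^ θ⌋₊ := Nat.le_floor (by exact_mod_cast hxθ)
  obtain ⟨hlogw, hlogw'⟩ := log_floor_rpow_bounds hx1 hθ0.le
  rw [div_le_iff₀ hθ0] at hlogθ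
  rw [div_le_iff₀ hη0] at hlogM
  set P := splitPrimes ⌊x ^ θ⌋₊ with hP
  set Q := splitPrimes ⌊x ^ (δ + 2 * η)⌋₊ \ splitPrimes ⌊x ^ (δ + η)⌋₊ with hQ
  have hQgt : ∀ q ∈ Q, x ^ (δ + η) < (q : ℝ) := by
    intro q hq
    obtain ⟨hq1, hq2⟩ := Finset.mem_sdiff.1 hq
    by_contra! h
    exact hq2 (mem_splitPrimes.2 ⟨Nat.le_floor h, (mem_splitPrimes.1 hq1).2⟩)
  have hPQ : Disjoint P Q := by
    refine Finset.disjoint_sdiff.mono_left (splitPrimes_subset (Nat.floor_le_floor ?_))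
    exact Real.rpow_le_rpow_of_exponent_le hx1 (by linarith)
  have hQz : ∀ q ∈ Q, z ≤ (q : ℝ) := by
    intro q hq
    refine hz.trans (le_trans ?_ (hQgt q hq).le)
    rw [Real.rpow_add hx0, mul_comm]
    gcongr
  have hQy : ∀ q ∈ Q, (q : ℝ) ≤ x ^ (δ + 2 * η) := by
    intro q hq
    exact (Nat.le_floor_iff (by positivity)).1 (mem_splitPrimes.1 (Finset.mem_sdiff.1 hq).1).1
  have hxle : 2 * (Real.exp (η * Real.log x) * x ^ (δ + 2 * η)) ≤ x := by
    have h1 : Real.exp (η * Real.log x) = x ^ η := by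
      rw [Real.rpow_def_of_pos hx0, mul_comm]
    calc _ ≤ x ^ η * (x ^ η * x ^ (δ + 2 * η)) := by
          rw [h1]
          gcongr
      _ = x := by
          rw [← Real.rpow_add hx0, ← Real.rpow_add hx0,
            show η + (η + (δ + 2 * η)) = 1 by linarith, Real.rpow_one]
  have hmain := sum_filter_mul_sum_inv_le k (fun p hp => (mem_splitPrimes.1 hp).2)
    (fun q hq => (mem_splitPrimes.1 (Finset.mem_sdiff.1 hq).1).2) hPQ hQz hQy hxle
  refine le_trans ?_ hmain
  have hmarkov : ∑ p ∈ P, 2 ^ k / (p : ℝ) * Real.log p ≤ η * Real.log x / 2 := by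
    have h1 := (abs_le.1 (hM ⌊x ^ θ⌋₊ (by omega))).2
    have h2 : ∑ p ∈ P, 2 ^ k / (p : ℝ) * Real.log p = 2 * K * ∑ p ∈ P, Real.log p / p := by
      rw [Finset.mul_sum, ← h2k]
      exact Finset.sum_congr rfl fun p _ => by ring
    rw [h2]
    have h3 : ∑ p ∈ P, Real.log p / p ≤ θ * Real.log x / 2 + M := by linarith
    have h4 := mul_le_mul_of_nonneg_left h3 (show (0 : ℝ) ≤ 2 * K by positivity)
    have h5 : 2 * K * (θ * Real.log x / 2 + M) = K * θ * Real.log x + 2 * K * M := by ring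
    rw [h5, hKθ] at h4
    linarith
  have hhalf := half_prod_one_add_le_sum_powerset_filter P (g := fun p : ℕ => 2 ^ k / (p : ℝ))
    (h := fun p : ℕ => Real.log p) (fun p => by positivity) (fun p => Real.log_natCast_nonneg p)
    (show 0 < η * Real.log x by positivity) hmarkov
  have hlow : c₁ * (θ / 2) ^ K * Real.log x ^ K ≤ ∏ p ∈ P, (1 + 2 ^ k / (p : ℝ)) := by
    rw [h2k, mul_assoc, ← mul_pow]
    refine le_trans ?_ (hprod _ hw2)
    gcongr
    linarith
  have hlow' := (div_le_div_of_nonneg_right hlow zero_le_two).trans hhalf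
  calc _ = c₁ * (θ / 2) ^ K * Real.log x ^ K / 2 * c₂ / 2 := by ring
    _ ≤ _ := by
      refine div_le_div_of_nonneg_right (mul_le_mul hlow' hinv hc₂.le ?_) zero_le_two
      exact Finset.sum_nonneg fun T _ => Finset.prod_nonneg fun p _ => by positivity
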